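/- Let G be a group with generators x₁,…,xₙ whose images x̄_i in the abelianization G/[G,G] have finite orders q₁,…,q_p (for 1 ≤ i ≤ p, with the q_i distinct, q = max{q₁,…,q_p}) and let w be a word in x₁,…,xₙ with [w] ≠ 1 in G. Then in the free product G ∗ F(a, α) the n+3 elements aαa⁻¹, αaα⁻¹, a^{-q_i} x_i α^{q_i} for 1 ≤ i ≤ p, a^{-(q+i)} x_i α^{(q+i)} for p+1 ≤ i ≤ n, and [w, α²] form a basis of a free subgroup of rank n+3. -/

import Mathlib

open Monoid.Coprod

/-- The family of `n+3` elements of the free product `G ∗ F(a, α)`, where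
`F(a, α) = FreeGroup (Fin 2)` with `a = FreeGroup.of 0` and `α = FreeGroup.of 1`:
`aαa⁻¹`, `αaα⁻¹`, `a^{-qᵢ} xᵢ α^{qᵢ}` for `1 ≤ i ≤ p`,
`a^{-(q+i)} xᵢ α^{q+i}` for `p+1 ≤ i ≤ n` (indexed by `Sum.inl i` with zero-based
`i`, where `q = max {q₁, …, q_p}`), and `[w, α²] = w α² w⁻¹ α⁻²`. -/
def lhsFamily (G : Type*) [Group G] (n p : ℕ) (x : Fin n → G) (q : Fin p → ℕ)
    (w : FreeGroup (Fin n)) :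
    Fin n ⊕ Fin 3 → G ∗ FreeGroup (Fin 2) :=
  let a : G ∗ FreeGroup (Fin 2) := Monoid.Coprod.inr (FreeGroup.of 0)
  let al : G ∗ FreeGroup (Fin 2) := Monoid.Coprod.inr (FreeGroup.of 1)
  let W : G ∗ FreeGroup (Fin 2) := Monoid.Coprod.inl (FreeGroup.lift x w)
  let Q : ℕ := Finset.univ.sup q
  fun j => match j with
  | Sum.inl i =>
      if h : (i : ℕ) < p then
        a ^ (-(q ⟨i, h⟩ : ℤ)) * Monoid.Coprod.inl (x i) * al ^ (q ⟨i, h⟩)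
      else
        a ^ (-((Q + (i : ℕ) + 1 : ℕ) : ℤ)) * Monoid.Coprod.inl (x i) *
          al ^ (Q + (i : ℕ) + 1)
  | Sum.inr t =>
      if t = 0 then a * al * a⁻¹
      else if t = 1 then al * a * al⁻¹
      else W * al ^ 2 * W⁻¹ * (al ^ 2)⁻¹

theorem cancel_mid {H : Type*} [Group H] (a b c : H) : a * b⁻¹ * (b * c) = a * c := by
  group

theorem perm_inv_apply {X : Type*} (f : Equiv.Perm X) (z : X) : f⁻¹ (f z) = z :=
  f.symm_apply_apply z

/-- A finite partial injection, with labels, extends to a permutation of `Y × Φ`. -/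
theorem exists_labelled_perm {ι Y Φ : Type*} [Finite ι] [Group Φ] (f g : ι → Y)
    (hf : Function.Injective f) (hg : Function.Injective g) (lab : ι → Φ) :
    ∃ τ : Equiv.Perm (Y × Φ), ∀ i h, τ (f i, h) = (g i, lab i * h) := by
  obtain ⟨m, ⟨e⟩⟩ := Finite.exists_equiv_fin ι
  have hm := (MulAction.isMultiplyPretransitive_iff (G := Equiv.Perm Y) (α := Y)).1
    (Equiv.Perm.isMultiplyPretransitive Y m)
  obtain ⟨σ, hσ⟩ := hm ⟨f ∘ e.symm, hf.comp e.symm.injective⟩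
    ⟨g ∘ e.symm, hg.comp e.symm.injective⟩
  have hσf : ∀ i, σ (f i) = g i := by
    intro i
    have := DFunLike.congr_fun hσ (e i)
    simpa using this
  let L : Y → Φ := Function.extend f lab 1
  refine ⟨⟨fun z => (σ z.1, L z.1 * z.2), fun z => (σ.symm z.1, (L (σ.symm z.1))⁻¹ * z.2),
    fun z => by simp, fun z => by simp⟩, fun i h => ?_⟩
  simp [L, hσf, hf.extend_apply]

/-- The action of `G` on `(ℤ × G) × Φ` by left multiplication on the middle factor. -/
def midAct (G Φ : Type*) [Group G] : G →* Equiv.Perm ((ℤ × G) × Φ) where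
  toFun g := ⟨fun z => ((z.1.1, g * z.1.2), z.2), fun z => ((z.1.1, g⁻¹ * z.1.2), z.2),
    fun z => by simp, fun z => by simp⟩
  map_one' := by ext z <;> simp
  map_mul' g h := by ext z <;> simp [mul_assoc]

@[simp] theorem midAct_apply (G Φ : Type*) [Group G] (g : G) (c : ℤ) (y : G) (h : Φ) :
    midAct G Φ g ((c, y), h) = ((c, g * y), h) := rfl

/-- If every generator acts on a copy of the free group as left translation, the lift is
injective. -/
theorem lift_injective_of_act {I K X : Type*} [Group K] (f : I → K)
    (ρ : K →* Equiv.Perm X) (e : FreeGroup I → X) (he : Function.Injective e)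
    (h : ∀ i g, ρ (f i) (e g) = e (FreeGroup.of i * g)) :
    Function.Injective (FreeGroup.lift f) := by
  have key : ∀ u : FreeGroup I, ∀ g, ρ (FreeGroup.lift f u) (e g) = e (u * g) := by
    intro u
    induction u using FreeGroup.induction_on with
    | C1 => simp
    | of i => intro g; simpa using h i g
    | inv_of i _ =>
      intro g
      rw [map_inv, map_inv, Equiv.Perm.inv_eq_iff_eq, FreeGroup.lift_apply_of, h]
      simp
    | mul u v hu hv => intro g; simp [hu, hv, mul_assoc]
  rw [injective_iff_map_eq_one]
  intro u hu
  have := key u 1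
  rw [hu, map_one, Equiv.Perm.one_apply] at this
  simpa using (he this).symm

theorem core (G : Type*) [Group G] (n : ℕ) (x : Fin n → G) (k : Fin n → ℕ)
    (hk : Function.Injective k) (hk1 : ∀ i, 1 ≤ k i) (W : G) (hW : W ≠ 1)
    (fam : Fin n ⊕ Fin 3 → G ∗ FreeGroup (Fin 2))
    (h1 : ∀ i, fam (Sum.inl i) =
      (Monoid.Coprod.inr (FreeGroup.of 0) ^ (k i))⁻¹ * Monoid.Coprod.inl (x i) *
        Monoid.Coprod.inr (FreeGroup.of 1) ^ (k i))
    (h2 : fam (Sum.inr 0) = Monoid.Coprod.inr (FreeGroup.of 0) *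
      Monoid.Coprod.inr (FreeGroup.of 1) * (Monoid.Coprod.inr (FreeGroup.of 0))⁻¹)
    (h3 : fam (Sum.inr 1) = Monoid.Coprod.inr (FreeGroup.of 1) *
      Monoid.Coprod.inr (FreeGroup.of 0) * (Monoid.Coprod.inr (FreeGroup.of 1))⁻¹)
    (h4 : fam (Sum.inr 2) = Monoid.Coprod.inl W * Monoid.Coprod.inr (FreeGroup.of 1) ^ 2 *
      (Monoid.Coprod.inl W)⁻¹ * (Monoid.Coprod.inr (FreeGroup.of 1) ^ 2)⁻¹) :
    Function.Injective (FreeGroup.lift fam) := by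
  let Φ := FreeGroup (Fin n ⊕ Fin 3)
  let K : ℕ := Finset.univ.sup k
  have hK : ∀ i, k i ≤ K := fun i => Finset.le_sup (Finset.mem_univ i)
  have hk0 : ¬ ∃ i, k i = 0 := by
    rintro ⟨i, hi⟩
    have := hk1 i
    omega
  let μ : ℕ → Φ := Function.extend k (fun i => FreeGroup.of (Sum.inl i)) 1
  let Z : ℕ → G := Function.extend k x 1
  have hμ : ∀ i, μ (k i) = FreeGroup.of (Sum.inl i) := fun i => hk.extend_apply _ _ i
  have hZ : ∀ i, Z (k i) = x i := fun i => hk.extend_apply _ _ i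
  have hμ0 : μ 0 = 1 := Function.extend_apply' _ _ _ hk0
  have hZ0 : Z 0 = 1 := Function.extend_apply' _ _ _ hk0
  have hWa : W⁻¹ ≠ 1 := by simpa using hW
  have hWb : (1 : G) ≠ W⁻¹ := hWa.symm
  obtain ⟨τ, hτ⟩ := exists_labelled_perm (ι := Fin K ⊕ Fin 5) (Y := ℤ × G) (Φ := Φ)
    (Sum.elim (fun j => ((j : ℕ), 1)) ![(-3, 1), (-1, 1), (-2, 1), (-1, W⁻¹), (-4, 1)])
    (Sum.elim (fun j => ((j : ℕ) + 1, 1)) ![(0, 1), (-3, 1), (-2, 1), (-4, 1), (0, W⁻¹)])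
    (by
      rintro (i | i) (j | j) h
      · simp at h; congr 1; ext; omega
      · fin_cases j <;> simp at h <;> omega
      · fin_cases i <;> simp at h <;> omega
      · fin_cases i <;> fin_cases j <;> simp_all)
    (by
      rintro (i | i) (j | j) h
      · simp at h; congr 1; ext; omega
      · fin_cases j <;> simp at h <;> omega
      · fin_cases i <;> simp at h <;> omega
      · fin_cases i <;> fin_cases j <;> simp_all)
    (Sum.elim (fun j => μ (j + 1) * (μ j)⁻¹)
      ![1, 1, FreeGroup.of (Sum.inr 0), FreeGroup.of (Sum.inr 2), 1])
  obtain ⟨σ, hσ⟩ := exists_labelled_perm (ι := Fin K ⊕ Fin 2) (Y := ℤ × G) (Φ := Φ)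
    (Sum.elim (fun j => ((j : ℕ), Z j)) ![(-2, 1), (-3, 1)])
    (Sum.elim (fun j => ((j : ℕ) + 1, Z (j + 1))) ![(0, 1), (-3, 1)])
    (by
      rintro (i | i) (j | j) h
      · simp at h; congr 1; ext; omega
      · fin_cases j <;> simp at h <;> omega
      · fin_cases i <;> simp at h <;> omega
      · fin_cases i <;> fin_cases j <;> simp_all)
    (by
      rintro (i | i) (j | j) h
      · simp at h; congr 1; ext; omega
      · fin_cases j <;> simp at h <;> omega
      · fin_cases i <;> simp at h <;> omega
      · fin_cases i <;> fin_cases j <;> simp_all)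
    (Sum.elim (fun _ => 1) ![1, FreeGroup.of (Sum.inr 1)])
  have hB : ∀ h, τ ((-3, 1), h) = ((0, 1), h) := fun h => by
    simpa using hτ (Sum.inr 0) h
  have hE : ∀ h, τ ((-1, 1), h) = ((-3, 1), h) := fun h => by
    simpa using hτ (Sum.inr 1) h
  have hA : ∀ h, τ ((-2, 1), h) = ((-2, 1), FreeGroup.of (Sum.inr 0) * h) := fun h => by
    simpa using hτ (Sum.inr 2) h
  have hP : ∀ h, τ ((-1, W⁻¹), h) = ((-4, 1), FreeGroup.of (Sum.inr 2) * h) := fun h => by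
    simpa using hτ (Sum.inr 3) h
  have hP1 : ∀ h, τ ((-4, 1), h) = ((0, W⁻¹), h) := fun h => by
    simpa using hτ (Sum.inr 4) h
  have sA : ∀ h, σ ((-2, 1), h) = ((0, 1), h) := fun h => by
    simpa using hσ (Sum.inr 0) h
  have sB : ∀ h, σ ((-3, 1), h) = ((-3, 1), FreeGroup.of (Sum.inr 1) * h) := fun h => by
    simpa using hσ (Sum.inr 1) h
  have hC : ∀ j, j ≤ K → ∀ h, (τ ^ j) ((0, 1), h) = (((j : ℤ), 1), μ j * h) := by
    intro j
    induction j with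
    | zero => intro _ h; simp [hμ0]
    | succ j ih =>
      intro hj h
      have := hτ (Sum.inl ⟨j, hj⟩) (μ j * h)
      rw [pow_succ', Equiv.Perm.mul_apply, ih (by omega)]
      have e : μ (j + 1) * (μ j)⁻¹ * (μ j * h) = μ (j + 1) * h :=
        cancel_mid (μ (j + 1)) (μ j) h
      simp only [Sum.elim_inl] at this
      rw [e] at this
      simpa using this
  have hD : ∀ j, j ≤ K → ∀ h, (σ ^ j) ((0, 1), h) = (((j : ℤ), Z j), h) := by
    intro j
    induction j with
    | zero => intro _ h; simp [hZ0]
    | succ j ih =>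
      intro hj h
      have := hσ (Sum.inl ⟨j, hj⟩) h
      rw [pow_succ', Equiv.Perm.mul_apply, ih (by omega)]
      simpa using this
  let ρ : G ∗ FreeGroup (Fin 2) →* Equiv.Perm ((ℤ × G) × Φ) :=
    Monoid.Coprod.lift (midAct G Φ) (FreeGroup.lift ![σ, τ])
  have ρl : ∀ g, ρ (Monoid.Coprod.inl g) = midAct G Φ g := fun g => by simp [ρ]
  have ρa : ρ (Monoid.Coprod.inr (FreeGroup.of 0)) = σ := by simp [ρ]
  have ρb : ρ (Monoid.Coprod.inr (FreeGroup.of 1)) = τ := by simp [ρ]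
  refine lift_injective_of_act fam ρ (fun g => ((0, 1), g)) (fun g h e => by simpa using e) ?_
  rintro (i | t) g
  · rw [h1]
    simp only [map_mul, map_inv, map_pow, ρl, ρa, ρb, Equiv.Perm.mul_apply]
    rw [Equiv.Perm.inv_eq_iff_eq, hC _ (hK i), hD _ (hK i), midAct_apply, hμ, hZ, mul_one]
  · fin_cases t
    · change ρ (fam (Sum.inr 0)) _ = ((0, 1), FreeGroup.of (Sum.inr 0) * g)
      rw [h2]
      simp only [map_mul, map_inv, ρa, ρb, Equiv.Perm.mul_apply]
      rw [← sA g, perm_inv_apply, hA, sA]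
    · change ρ (fam (Sum.inr 1)) _ = ((0, 1), FreeGroup.of (Sum.inr 1) * g)
      rw [h3]
      simp only [map_mul, map_inv, ρa, ρb, Equiv.Perm.mul_apply]
      rw [← hB g, perm_inv_apply, sB, hB]
    · change ρ (fam (Sum.inr 2)) _ = ((0, 1), FreeGroup.of (Sum.inr 2) * g)
      rw [h4]
      simp only [map_mul, map_inv, map_pow, ρl, ρb, Equiv.Perm.mul_apply]
      have e1 : ((0, 1), g) = (τ ^ 2) ((-1, 1), g) := by
        rw [pow_two, Equiv.Perm.mul_apply, hE, hB]
      rw [e1, perm_inv_apply, ← map_inv, midAct_apply G Φ W⁻¹, mul_one, pow_two,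
        Equiv.Perm.mul_apply, hP, hP1, midAct_apply, mul_inv_cancel]


/-- Let `G` be a group with generators `x₁,…,xₙ` whose images
`x̄ᵢ` in the abelianization `G/[G,G]` have finite orders `q₁,…,q_p` (for
`1 ≤ i ≤ p`, with the `qᵢ` distinct, `q = max {q₁,…,q_p}`) and let `w` be a word in
`x₁,…,xₙ` with `[w] ≠ 1` in `G`.  Then in the free product `G ∗ F(a, α)` the `n+3`
elements `aαa⁻¹`, `αaα⁻¹`, `a^{-qᵢ} xᵢ α^{qᵢ}` for `1 ≤ i ≤ p`,
`a^{-(q+i)} xᵢ α^{q+i}` for `p+1 ≤ i ≤ n`, and `[w, α²]` form a basis of a free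
subgroup of rank `n+3`. -/
theorem lhsFamily_injective (G : Type*) [Group G] (n p : ℕ) (hp1 : 1 ≤ p)
    (hpn : p ≤ n) (x : Fin n → G)
    (hgen : Subgroup.closure (Set.range x) = ⊤)
    (q : Fin p → ℕ) (hq1 : ∀ i, 1 ≤ q i) (hqinj : Function.Injective q)
    (horder : ∀ i : Fin p, orderOf (Abelianization.of (x (Fin.castLE hpn i))) = q i)
    (w : FreeGroup (Fin n)) (hw : FreeGroup.lift x w ≠ 1) :
    Function.Injective (FreeGroup.lift (lhsFamily G n p x q w) :
      FreeGroup (Fin n ⊕ Fin 3) →* G ∗ FreeGroup (Fin 2)) := by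
  let Q : ℕ := Finset.univ.sup q
  have hQ : ∀ i, q i ≤ Q := fun i => Finset.le_sup (Finset.mem_univ i)
  let k : Fin n → ℕ := fun i => if h : (i : ℕ) < p then q ⟨i, h⟩ else Q + (i : ℕ) + 1
  refine core G n x k ?_ ?_ (FreeGroup.lift x w) hw _ ?_ ?_ ?_ ?_
  · intro i j hij
    simp only [k] at hij
    split_ifs at hij with hi hj hj
    · have := hqinj hij
      ext
      simpa using this
    · have := hQ ⟨i, hi⟩
      omega
    · have := hQ ⟨j, hj⟩
      omega
    · ext
      omega
  · intro i
    simp only [k]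
    split_ifs with hi
    · exact hq1 _
    · omega
  · intro i
    by_cases hi : (i : ℕ) < p
    · simp [lhsFamily, k, hi]
    · simp only [lhsFamily, k, hi, dite_false, zpow_neg, zpow_natCast, Q]
  · simp [lhsFamily]
  · simp [lhsFamily]
  · simp [lhsFamily]
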